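/- Let K be a field of characteristic zero, let α and β be nonzero elements of K, and let a, b, c, d be positive integers with a·d > b·c. Let I be the ideal of K[x, y] generated by x^a − α·y^b and x^c − β·y^d, set A = K[x, y]/I, and let m be the maximal ideal of A generated by the residue classes of x and y. Then the localization A_m of A at m is a finite-dimensional K-vector space of dimension exactly b·c. -/

import Mathlib

open MvPolynomial

set_option synthInstance.maxHeartbeats 1000000
set_option maxHeartbeats 1000000

/-- The ideal `I = (x^a − α·y^b, x^c − β·y^d)` of `K[x,y]`. -/
noncomputable def binomialIdeal (K : Type*) [Field K] (α β : K) (a b c d : ℕ) :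
    Ideal (MvPolynomial (Fin 2) K) :=
  Ideal.span {(X 0 : MvPolynomial (Fin 2) K) ^ a - C α * (X 1) ^ b,
    (X 0 : MvPolynomial (Fin 2) K) ^ c - C β * (X 1) ^ d}

/-- The quotient ring `A = K[x,y]/I`. -/
noncomputable abbrev binomialQuot (K : Type*) [Field K] (α β : K) (a b c d : ℕ) :=
  MvPolynomial (Fin 2) K ⧸ binomialIdeal K α β a b c d

/-- The ideal `m = (x̄, ȳ)` of `A = K[x,y]/I` generated by the residue classes of
`x` and `y`. -/
noncomputable def originIdeal (K : Type*) [Field K] (α β : K) (a b c d : ℕ) :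
    Ideal (binomialQuot K α β a b c d) :=
  Ideal.span {Ideal.Quotient.mk (binomialIdeal K α β a b c d) (X 0),
    Ideal.Quotient.mk (binomialIdeal K α β a b c d) (X 1)}

/-- The weight of the exponent `(i, j)` for which both rewriting rules `x^c ↦ β y^d` and
`y^b ↦ α⁻¹ x^a` are strictly increasing. -/
def binomialWeight (a b c d i j : ℕ) : ℕ := (b + d) * i + (a + c) * j

lemma binomialWeight_add (a b c d i j k l : ℕ) :
    binomialWeight a b c d (i + k) (j + l) =
      binomialWeight a b c d i j + binomialWeight a b c d k l := by
  simp only [binomialWeight]; ring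

lemma binomialWeight_lt_of_le_left {a b c d : ℕ} (h : b * c < a * d) {i : ℕ} (hi : c ≤ i)
    (j : ℕ) : binomialWeight a b c d i j < binomialWeight a b c d (i - c) (j + d) := by
  obtain ⟨k, rfl⟩ := Nat.exists_eq_add_of_le' hi
  simp only [binomialWeight, Nat.add_sub_cancel]
  nlinarith

lemma binomialWeight_lt_of_le_right {a b c d : ℕ} (h : b * c < a * d) (i : ℕ) {j : ℕ}
    (hj : b ≤ j) : binomialWeight a b c d i j < binomialWeight a b c d (i + a) (j - b) := by
  obtain ⟨k, rfl⟩ := Nat.exists_eq_add_of_le' hj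
  simp only [binomialWeight, Nat.add_sub_cancel]
  nlinarith

lemma binomialWeight_lt_of_lt {a b c d i j : ℕ} (hb : 0 < b) (hi : i < c) (hj : j < b) :
    binomialWeight a b c d i j < binomialWeight a b c d c b := by
  simp only [binomialWeight]
  nlinarith

section NormalForm

variable {K : Type*} [Field K]

/-- The normal form of `x^i y^j` under `x^c ↦ β y^d` and `y^b ↦ α⁻¹ x^a`, where monomials of
weight at least `N` are set to zero. -/
noncomputable def binomialNormalForm (α β : K) {a b c d : ℕ} (h : b * c < a * d) (N i j : ℕ) :
    ℕ × ℕ →₀ K :=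
  if N ≤ binomialWeight a b c d i j then 0
  else if _hi : c ≤ i then β • binomialNormalForm α β h N (i - c) (j + d)
  else if _hj : b ≤ j then α⁻¹ • binomialNormalForm α β h N (i + a) (j - b)
  else Finsupp.single (i, j) 1
termination_by N - binomialWeight a b c d i j
decreasing_by
  · have := binomialWeight_lt_of_le_left h _hi j
    omega
  · have := binomialWeight_lt_of_le_right h i _hj
    omega

variable (α β : K) {a b c d : ℕ} (h : b * c < a * d) (N : ℕ)

lemma binomialNormalForm_eq_zero {i j : ℕ} (hN : N ≤ binomialWeight a b c d i j) :
    binomialNormalForm α β h N i j = 0 := by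
  rw [binomialNormalForm, if_pos hN]

lemma binomialNormalForm_of_lt {i j : ℕ} (hN : binomialWeight a b c d i j < N)
    (hi : i < c) (hj : j < b) :
    binomialNormalForm α β h N i j = Finsupp.single (i, j) 1 := by
  rw [binomialNormalForm, if_neg hN.not_ge, dif_neg hi.not_ge, dif_neg hj.not_ge]

lemma binomialNormalForm_of_le_left {i : ℕ} (hi : c ≤ i) (j : ℕ) :
    binomialNormalForm α β h N i j = β • binomialNormalForm α β h N (i - c) (j + d) := by
  by_cases hN : N ≤ binomialWeight a b c d i j
  · rw [binomialNormalForm_eq_zero α β h N hN, binomialNormalForm_eq_zero α β h N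
      (hN.trans (binomialWeight_lt_of_le_left h hi j).le), smul_zero]
  · rw [binomialNormalForm, if_neg hN, dif_pos hi]

lemma binomialNormalForm_of_le_right (i : ℕ) {j : ℕ} (hj : b ≤ j) :
    binomialNormalForm α β h N i j = α⁻¹ • binomialNormalForm α β h N (i + a) (j - b) := by
  by_cases hN : N ≤ binomialWeight a b c d i j
  · rw [binomialNormalForm_eq_zero α β h N hN, binomialNormalForm_eq_zero α β h N
      (hN.trans (binomialWeight_lt_of_le_right h i hj).le), smul_zero]
  by_cases hi : c ≤ i
  · have hlt := binomialWeight_lt_of_le_left h hi j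
    rw [binomialNormalForm_of_le_left α β h N hi,
      binomialNormalForm_of_le_right (i - c) (le_add_right hj),
      binomialNormalForm_of_le_left α β h N (le_add_right hi), smul_comm,
      Nat.sub_add_comm hi, Nat.sub_add_comm hj]
  · rw [binomialNormalForm, if_neg hN, dif_neg hi, dif_pos hj]
termination_by N - binomialWeight a b c d i j

/-- The `K`-linear extension of `binomialNormalForm` to `K[x, y]`. -/
noncomputable def binomialReduce : MvPolynomial (Fin 2) K →ₗ[K] (ℕ × ℕ →₀ K) :=
  (basisMonomials (Fin 2) K).constr K fun m => binomialNormalForm α β h N (m 0) (m 1)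

lemma binomialReduce_monomial (m : Fin 2 →₀ ℕ) (r : K) :
    binomialReduce α β h N (monomial m r) = r • binomialNormalForm α β h N (m 0) (m 1) := by
  have h1 : binomialReduce α β h N (monomial m 1) = binomialNormalForm α β h N (m 0) (m 1) := by
    simpa [binomialReduce] using (basisMonomials (Fin 2) K).constr_basis K
      (fun m => binomialNormalForm α β h N (m 0) (m 1)) m
  rw [← h1, ← map_smul, smul_monomial, smul_eq_mul, mul_one]

lemma binomialReduce_monomial_mul (m : Fin 2 →₀ ℕ) (r : K) (i j : ℕ) :
    binomialReduce α β h N (monomial m r * (X 0 ^ i * X 1 ^ j)) =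
      r • binomialNormalForm α β h N (m 0 + i) (m 1 + j) := by
  rw [X_pow_eq_monomial, X_pow_eq_monomial, monomial_mul, monomial_mul,
    binomialReduce_monomial]
  simp

/-- The largest ideal contained in the kernel of `binomialReduce`. -/
noncomputable def binomialReduceIdeal : Ideal (MvPolynomial (Fin 2) K) where
  carrier := {p | ∀ q, binomialReduce α β h N (q * p) = 0}
  zero_mem' q := by simp
  add_mem' hp hq r := by rw [mul_add, map_add, hp, hq, add_zero]
  smul_mem' s p hp q := by rw [smul_eq_mul, ← mul_assoc, hp]

lemma mem_binomialReduceIdeal_of_monomial {p : MvPolynomial (Fin 2) K}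
    (hp : ∀ m r, binomialReduce α β h N (monomial m r * p) = 0) :
    p ∈ binomialReduceIdeal α β h N := by
  intro q
  induction q using MvPolynomial.induction_on' with
  | monomial m r => exact hp m r
  | add q₁ q₂ h₁ h₂ => rw [add_mul, map_add, h₁, h₂, add_zero]

lemma binomialReduce_eq_zero {p : MvPolynomial (Fin 2) K}
    (hp : p ∈ binomialReduceIdeal α β h N) : binomialReduce α β h N p = 0 := by
  simpa using hp 1

variable {α} in
lemma binomialIdeal_le_binomialReduceIdeal (hα : α ≠ 0) :
    binomialIdeal K α β a b c d ≤ binomialReduceIdeal α β h N := by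
  rw [binomialIdeal, Ideal.span_le, Set.insert_subset_iff, Set.singleton_subset_iff]
  constructor <;> refine mem_binomialReduceIdeal_of_monomial α β h N fun m r => ?_
  · have h₁ := binomialReduce_monomial_mul α β h N m r a 0
    have h₂ := binomialReduce_monomial_mul α β h N m r 0 b
    rw [pow_zero, mul_one, add_zero] at h₁
    rw [pow_zero, one_mul, add_zero] at h₂
    rw [mul_sub, mul_left_comm, C_mul', map_sub, map_smul, h₁, h₂,
      binomialNormalForm_of_le_right α β h N (m 0) (Nat.le_add_left b _), Nat.add_sub_cancel,
      smul_comm r, smul_inv_smul₀ hα, sub_self]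
  · have h₁ := binomialReduce_monomial_mul α β h N m r c 0
    have h₂ := binomialReduce_monomial_mul α β h N m r 0 d
    rw [pow_zero, mul_one, add_zero] at h₁
    rw [pow_zero, one_mul, add_zero] at h₂
    rw [mul_sub, mul_left_comm, C_mul', map_sub, map_smul, h₁, h₂,
      binomialNormalForm_of_le_left α β h N (Nat.le_add_left c _), Nat.add_sub_cancel,
      smul_comm r, sub_self]

lemma pow_mul_monomial_mem_binomialReduceIdeal (hb : 0 < b) (hc : 0 < c)
    {v : MvPolynomial (Fin 2) K} (hv : v ∈ Ideal.span {X 0, X 1}) (n i j : ℕ)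
    (hN : N ≤ binomialWeight a b c d i j + n) :
    v ^ n * (X 0 ^ i * X 1 ^ j) ∈ binomialReduceIdeal α β h N := by
  induction n generalizing i j with
  | zero =>
    rw [pow_zero, one_mul]
    refine mem_binomialReduceIdeal_of_monomial α β h N fun m r => ?_
    rw [binomialReduce_monomial_mul, binomialNormalForm_eq_zero, smul_zero]
    rw [binomialWeight_add]
    omega
  | succ n ih =>
    obtain ⟨p, q, rfl⟩ := Ideal.mem_span_pair.1 hv
    have h₁ : binomialWeight a b c d 1 0 = b + d := by simp [binomialWeight]
    have h₂ : binomialWeight a b c d 0 1 = a + c := by simp [binomialWeight]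
    have hx := ih (i + 1) (j + 0) (by rw [binomialWeight_add, h₁]; omega)
    have hy := ih (i + 0) (j + 1) (by rw [binomialWeight_add, h₂]; omega)
    convert add_mem (Ideal.mul_mem_left _ p hx) (Ideal.mul_mem_left _ q hy) using 1
    ring

end NormalForm

lemma MvPolynomial.sub_C_constantCoeff_mem_span {K : Type*} [CommRing K]
    (p : MvPolynomial (Fin 2) K) : p - C (constantCoeff p) ∈ Ideal.span {X 0, X 1} := by
  induction p using MvPolynomial.induction_on with
  | C r => simp
  | add p q hp hq =>
    rw [map_add, map_add, add_sub_add_comm]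
    exact add_mem hp hq
  | mul_X p i =>
    rw [map_mul, constantCoeff_X, mul_zero, map_zero, sub_zero]
    refine Ideal.mul_mem_left _ _ (Ideal.subset_span ?_)
    fin_cases i <;> simp

section Local

variable {K R : Type*} [Field K] [CommRing R] [Algebra K R] {α β : K} {a b c d : ℕ} {x y : R}

lemma pow_mul_pow_eq_of_le_left (hx : x ^ c = β • y ^ d) {i : ℕ} (hi : c ≤ i) (j : ℕ) :
    x ^ i * y ^ j = β • (x ^ (i - c) * y ^ (j + d)) := by
  rw [← pow_sub_mul_pow x hi, hx, pow_add]
  simp only [mul_smul_comm, smul_mul_assoc]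
  congr 1
  ring

lemma pow_mul_pow_eq_of_le_right (hα : α ≠ 0) (hy : x ^ a = α • y ^ b) (i : ℕ) {j : ℕ}
    (hj : b ≤ j) : x ^ i * y ^ j = α⁻¹ • (x ^ (i + a) * y ^ (j - b)) := by
  rw [← pow_sub_mul_pow y hj, pow_add, hy]
  simp only [mul_smul_comm, smul_mul_assoc]
  rw [inv_smul_smul₀ hα]
  ring

lemma exists_pow_mul_pow_eq_smul (hα : α ≠ 0) (hb : 0 < b) (h : b * c < a * d)
    (hx : x ^ c = β • y ^ d) (hy : x ^ a = α • y ^ b) {i j : ℕ}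
    (hN : binomialWeight a b c d c b ≤ binomialWeight a b c d i j) (k : ℕ) :
    ∃ i' j' κ, binomialWeight a b c d i j + k ≤ binomialWeight a b c d i' j' ∧
      x ^ i * y ^ j = (κ : K) • (x ^ i' * y ^ j') := by
  induction k with
  | zero => exact ⟨i, j, 1, le_rfl, (one_smul _ _).symm⟩
  | succ k ih =>
    obtain ⟨i', j', κ, hw, he⟩ := ih
    by_cases hi : c ≤ i'
    · refine ⟨i' - c, j' + d, κ * β, ?_, ?_⟩
      · have := binomialWeight_lt_of_le_left h hi j'
        omega
      · rw [he, pow_mul_pow_eq_of_le_left hx hi, smul_smul]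
    by_cases hj : b ≤ j'
    · refine ⟨i' + a, j' - b, κ * α⁻¹, ?_, ?_⟩
      · have := binomialWeight_lt_of_le_right h i' hj
        omega
      · rw [he, pow_mul_pow_eq_of_le_right hα hy i' hj, smul_smul]
    · have := binomialWeight_lt_of_lt (a := a) (d := d) hb (not_le.1 hi) (not_le.1 hj)
      omega

lemma pow_mul_pow_eq_zero [IsLocalRing R] [IsNoetherianRing R] (hα : α ≠ 0) (hb : 0 < b)
    (h : b * c < a * d) (hx : x ^ c = β • y ^ d) (hy : x ^ a = α • y ^ b)
    (hxm : x ∈ IsLocalRing.maximalIdeal R) (hym : y ∈ IsLocalRing.maximalIdeal R) {i j : ℕ}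
    (hN : binomialWeight a b c d c b ≤ binomialWeight a b c d i j) :
    x ^ i * y ^ j = 0 := by
  rw [← Ideal.mem_bot, ← Ideal.iInf_pow_eq_bot_of_isLocalRing (IsLocalRing.maximalIdeal R)
    Ideal.IsPrime.ne_top', Ideal.mem_iInf]
  intro n
  obtain ⟨i', j', κ, hw, he⟩ :=
    exists_pow_mul_pow_eq_smul hα hb h hx hy hN ((a + b + c + d) * n)
  have hn : n ≤ i' + j' := by
    by_contra! hlt
    simp only [binomialWeight] at hw
    nlinarith
  rw [he, Algebra.smul_def]
  refine Ideal.mul_mem_left _ _ (Ideal.pow_le_pow_right hn ?_)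
  rw [pow_add]
  exact Ideal.mul_mem_mul (Ideal.pow_mem_pow hxm _) (Ideal.pow_mem_pow hym _)

lemma pow_mul_pow_mem_span [IsLocalRing R] [IsNoetherianRing R] (hα : α ≠ 0) (hb : 0 < b)
    (h : b * c < a * d) (hx : x ^ c = β • y ^ d) (hy : x ^ a = α • y ^ b)
    (hxm : x ∈ IsLocalRing.maximalIdeal R) (hym : y ∈ IsLocalRing.maximalIdeal R) (i j : ℕ) :
    x ^ i * y ^ j ∈ Submodule.span K
      (Set.range fun k : Fin c × Fin b => x ^ (k.1 : ℕ) * y ^ (k.2 : ℕ)) := by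
  by_cases hN : binomialWeight a b c d c b ≤ binomialWeight a b c d i j
  · rw [pow_mul_pow_eq_zero hα hb h hx hy hxm hym hN]
    exact zero_mem _
  by_cases hi : c ≤ i
  · have := binomialWeight_lt_of_le_left h hi j
    rw [pow_mul_pow_eq_of_le_left hx hi]
    exact Submodule.smul_mem _ _
      (pow_mul_pow_mem_span hα hb h hx hy hxm hym (i - c) (j + d))
  by_cases hj : b ≤ j
  · have := binomialWeight_lt_of_le_right h i hj
    rw [pow_mul_pow_eq_of_le_right hα hy i hj]
    exact Submodule.smul_mem _ _
      (pow_mul_pow_mem_span hα hb h hx hy hxm hym (i + a) (j - b))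
  · exact Submodule.subset_span ⟨(⟨i, not_le.1 hi⟩, ⟨j, not_le.1 hj⟩), rfl⟩
termination_by binomialWeight a b c d c b - binomialWeight a b c d i j

end Local

/-- A localization of a `K`-algebra whose image in it is finite-dimensional is a quotient. -/
lemma IsLocalization.algebraMap_surjective_of_finite_range (K : Type*) {A R : Type*} [Field K]
    [CommRing A] [Algebra K A] (S : Submonoid A) [CommRing R] [Algebra A R] [Algebra K R]
    [IsScalarTower K A R] [IsLocalization S R]
    [FiniteDimensional K (IsScalarTower.toAlgHom K A R).range] :
    Function.Surjective (algebraMap A R) := by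
  intro r
  obtain ⟨⟨p, s⟩, hr⟩ := IsLocalization.surj S r
  let B := (IsScalarTower.toAlgHom K A R).range
  let s' : B := ⟨algebraMap A R s, s, rfl⟩
  have hu : IsUnit (algebraMap A R s) := IsLocalization.map_units R s
  have hinj : Function.Injective (LinearMap.mulLeft K s') := by
    intro u v huv
    exact Subtype.ext (hu.mul_left_cancel (congrArg Subtype.val huv))
  obtain ⟨⟨_, q, rfl⟩, hz⟩ := LinearMap.injective_iff_surjective.1 hinj
    ⟨algebraMap A R p, p, rfl⟩
  refine ⟨q, hu.mul_left_cancel ?_⟩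
  rw [mul_comm _ r, hr]
  exact congrArg Subtype.val hz

section Origin

variable {K : Type*} [Field K] {α β : K} {a b c d : ℕ}

lemma mk_mem_originIdeal_iff (ha : 0 < a) (hb : 0 < b) (hc : 0 < c) (hd : 0 < d)
    (p : MvPolynomial (Fin 2) K) :
    Ideal.Quotient.mk (binomialIdeal K α β a b c d) p ∈ originIdeal K α β a b c d ↔
      constantCoeff p = 0 := by
  have hI : ∀ q ∈ binomialIdeal K α β a b c d, constantCoeff q = 0 := by
    suffices binomialIdeal K α β a b c d ≤ RingHom.ker constantCoeff from fun q hq => this hq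
    rw [binomialIdeal, Ideal.span_le, Set.insert_subset_iff, Set.singleton_subset_iff]
    simp [RingHom.mem_ker, ha.ne', hb.ne', hc.ne', hd.ne']
  constructor
  · intro hp
    suffices originIdeal K α β a b c d ≤
        RingHom.ker (Ideal.Quotient.lift (binomialIdeal K α β a b c d) constantCoeff hI) by
      simpa [RingHom.mem_ker] using this hp
    rw [originIdeal, Ideal.span_le, Set.insert_subset_iff, Set.singleton_subset_iff]
    simp [RingHom.mem_ker]
  · intro hp
    have := Ideal.mem_map_of_mem (Ideal.Quotient.mk (binomialIdeal K α β a b c d))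
      (sub_C_constantCoeff_mem_span p)
    rwa [hp, map_zero, sub_zero, Ideal.map_span, Set.image_pair] at this

lemma originIdeal_isMaximal (ha : 0 < a) (hb : 0 < b) (hc : 0 < c) (hd : 0 < d) :
    (originIdeal K α β a b c d).IsMaximal := by
  have hcomap : (originIdeal K α β a b c d).comap (Ideal.Quotient.mk _) =
      RingHom.ker (constantCoeff (R := K) (σ := Fin 2)) := by
    ext p
    rw [Ideal.mem_comap, mk_mem_originIdeal_iff ha hb hc hd, RingHom.mem_ker]
  have hmax : (RingHom.ker (constantCoeff (R := K) (σ := Fin 2))).IsMaximal :=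
    RingHom.ker_isMaximal_of_surjective _ fun r => ⟨C r, constantCoeff_C _ r⟩
  rw [← hcomap] at hmax
  refine Ideal.map_comap_of_surjective _ Ideal.Quotient.mk_surjective
    (originIdeal K α β a b c d) ▸ (Ideal.map_eq_top_or_isMaximal_of_surjective _
      Ideal.Quotient.mk_surjective hmax).resolve_left fun htop => ?_
  rw [Ideal.map_comap_of_surjective _ Ideal.Quotient.mk_surjective,
    Ideal.eq_top_iff_one, ← map_one (Ideal.Quotient.mk _),
    mk_mem_originIdeal_iff ha hb hc hd, map_one] at htop
  exact one_ne_zero htop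

lemma mem_binomialReduceIdeal_of_mul_mem (hα : α ≠ 0) (hb : 0 < b) (hc : 0 < c)
    (h : b * c < a * d) (N : ℕ) {p q : MvPolynomial (Fin 2) K} (hq : constantCoeff q ≠ 0)
    (hqp : q * p ∈ binomialIdeal K α β a b c d) : p ∈ binomialReduceIdeal α β h N := by
  set v : MvPolynomial (Fin 2) K := 1 - C (constantCoeff q)⁻¹ * q with hv_def
  have hv : v ∈ Ideal.span {X 0, X 1} := by
    have h0 : constantCoeff v = 0 := by simp [hv_def, hq]
    simpa [h0] using sub_C_constantCoeff_mem_span v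
  have h₁ : (1 - v ^ N) * p ∈ binomialReduceIdeal α β h N := by
    obtain ⟨t, ht⟩ := one_sub_dvd_one_sub_pow v N
    have : (1 - v ^ N) * p = t * C (constantCoeff q)⁻¹ * (q * p) := by
      rw [ht, hv_def]; ring
    rw [this]
    exact Ideal.mul_mem_left _ _ (binomialIdeal_le_binomialReduceIdeal β h N hα hqp)
  have h₂ := pow_mul_monomial_mem_binomialReduceIdeal α β h N hb hc hv N 0 0 (by omega)
  convert add_mem h₁ (Ideal.mul_mem_left _ p h₂) using 1
  ring

/-- The monomials `x^i y^j` with `i < c` and `j < b` form a basis of the local ring at the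
origin. -/
lemma nonempty_basis_of_isLocalization_originIdeal (hα : α ≠ 0) (ha : 0 < a) (hb : 0 < b)
    (hc : 0 < c) (hd : 0 < d) (habcd : b * c < a * d) [(originIdeal K α β a b c d).IsPrime]
    (R : Type*) [CommRing R] [Algebra (binomialQuot K α β a b c d) R] [Algebra K R]
    [IsScalarTower K (binomialQuot K α β a b c d) R]
    [IsLocalization.AtPrime R (originIdeal K α β a b c d)] :
    Nonempty (Module.Basis (Fin c × Fin b) K R) := by
  have : IsLocalRing R := IsLocalization.AtPrime.isLocalRing R (originIdeal K α β a b c d)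
  let f : MvPolynomial (Fin 2) K →ₐ[K] R :=
    (IsScalarTower.toAlgHom K (binomialQuot K α β a b c d) R).comp
      (Ideal.Quotient.mkₐ K (binomialIdeal K α β a b c d))
  let x : R := f (X 0)
  let y : R := f (X 1)
  have hf0 : ∀ p ∈ binomialIdeal K α β a b c d, f p = 0 := fun p hp => by
    change algebraMap (binomialQuot K α β a b c d) R (Ideal.Quotient.mk _ p) = 0
    rw [Ideal.Quotient.eq_zero_iff_mem.2 hp, map_zero]
  have hy : x ^ a = α • y ^ b := by
    have := hf0 _ (Ideal.subset_span (Set.mem_insert _ _))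
    rwa [C_mul', map_sub, map_smul, map_pow, map_pow, sub_eq_zero] at this
  have hx : x ^ c = β • y ^ d := by
    have := hf0 _ (Ideal.subset_span (Set.mem_insert_of_mem _ rfl))
    rwa [C_mul', map_sub, map_smul, map_pow, map_pow, sub_eq_zero] at this
  have hxm : x ∈ IsLocalRing.maximalIdeal R :=
    (IsLocalization.AtPrime.to_map_mem_maximal_iff R (originIdeal K α β a b c d) _).2
      (Ideal.subset_span (Set.mem_insert _ _))
  have hym : y ∈ IsLocalRing.maximalIdeal R :=
    (IsLocalization.AtPrime.to_map_mem_maximal_iff R (originIdeal K α β a b c d) _).2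
      (Ideal.subset_span (Set.mem_insert_of_mem _ rfl))
  have : IsNoetherianRing R :=
    IsLocalization.isNoetherianRing (originIdeal K α β a b c d).primeCompl R inferInstance
  let e : Fin c × Fin b → R := fun k => x ^ (k.1 : ℕ) * y ^ (k.2 : ℕ)
  have hspan : ∀ p, f p ∈ Submodule.span K (Set.range e) := by
    intro p
    induction p using MvPolynomial.induction_on' with
    | monomial n r =>
      rw [monomial_eq, C_mul', map_smul, Finsupp.prod_fintype _ _ fun _ => pow_zero _,
        Fin.prod_univ_two, map_mul, map_pow, map_pow]
      exact Submodule.smul_mem _ _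
        (pow_mul_pow_mem_span hα hb habcd hx hy hxm hym (n 0) (n 1))
    | add p q hp hq =>
      rw [map_add]
      exact add_mem hp hq
  have hrange : ∀ s : binomialQuot K α β a b c d,
      algebraMap _ R s ∈ Submodule.span K (Set.range e) := by
    intro s
    obtain ⟨p, rfl⟩ := Ideal.Quotient.mk_surjective s
    exact hspan p
  have hfin : FiniteDimensional K
      (IsScalarTower.toAlgHom K (binomialQuot K α β a b c d) R).range := by
    have : FiniteDimensional K (Submodule.span K (Set.range e)) :=
      FiniteDimensional.span_of_finite K (Set.finite_range e)
    refine Submodule.finiteDimensional_of_le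
      (S₁ := Subalgebra.toSubmodule
        (IsScalarTower.toAlgHom K (binomialQuot K α β a b c d) R).range)
      (S₂ := Submodule.span K (Set.range e)) ?_
    rintro _ ⟨s, rfl⟩
    exact hrange s
  have htop : ⊤ ≤ Submodule.span K (Set.range e) := by
    intro r _
    obtain ⟨s, rfl⟩ :=
      IsLocalization.algebraMap_surjective_of_finite_range K (R := R)
        (originIdeal K α β a b c d).primeCompl r
    exact hrange s
  have hli : LinearIndependent K e := by
    rw [Fintype.linearIndependent_iff]
    intro g hg
    let p : MvPolynomial (Fin 2) K := ∑ k, g k • (X 0 ^ (k.1 : ℕ) * X 1 ^ (k.2 : ℕ))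
    have hp : algebraMap (binomialQuot K α β a b c d) R (Ideal.Quotient.mk _ p) = 0 := by
      change f p = 0
      simpa only [p, map_sum, map_smul, map_mul, map_pow] using hg
    obtain ⟨⟨s, hs⟩, hsp⟩ :=
      (IsLocalization.map_eq_zero_iff (originIdeal K α β a b c d).primeCompl R _).1 hp
    obtain ⟨q, rfl⟩ := Ideal.Quotient.mk_surjective s
    have hq : constantCoeff q ≠ 0 := fun h0 =>
      hs ((mk_mem_originIdeal_iff ha hb hc hd q).2 h0)
    have hqp : q * p ∈ binomialIdeal K α β a b c d := by
      rw [← Ideal.Quotient.eq_zero_iff_mem, map_mul]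
      exact hsp
    have hred := binomialReduce_eq_zero α β habcd (binomialWeight a b c d c b)
      (mem_binomialReduceIdeal_of_mul_mem hα hb hc habcd _ hq hqp)
    have hmon : ∀ k : Fin c × Fin b,
        binomialReduce α β habcd (binomialWeight a b c d c b)
          (X 0 ^ (k.1 : ℕ) * X 1 ^ (k.2 : ℕ)) = Finsupp.single ((k.1 : ℕ), (k.2 : ℕ)) 1 := by
      intro k
      have := binomialReduce_monomial_mul α β habcd (binomialWeight a b c d c b) 0 1 k.1 k.2
      rw [monomial_zero', map_one, one_mul, one_smul] at this
      simpa [binomialNormalForm_of_lt α β habcd _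
        (binomialWeight_lt_of_lt hb k.1.2 k.2.2) k.1.2 k.2.2] using this
    intro k
    have hk := DFunLike.congr_fun hred ((k.1 : ℕ), (k.2 : ℕ))
    simp only [p, map_sum, map_smul, hmon, Finsupp.coe_finsetSum, Finset.sum_apply,
      Finsupp.smul_apply, Finsupp.single_apply, Prod.mk.injEq, Fin.val_inj,
      ← Prod.ext_iff] at hk
    simpa using hk
  exact ⟨Module.Basis.mk hli htop⟩

end Origin

/-- Let `K` be a field of characteristic zero, `α, β` nonzero elements of `K`, and
`a, b, c, d` positive integers with `a·d > b·c`.  Let `I` be the ideal of `K[x,y]`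
generated by `x^a − α·y^b` and `x^c − β·y^d`, set `A = K[x,y]/I`, and let `m` be the
maximal ideal of `A` generated by the residue classes of `x` and `y`.  Then the
localization `A_m` of `A` at `m` is a finite-dimensional `K`-vector space of dimension
exactly `b·c`. -/
theorem localization_at_origin_finrank (K : Type*) [Field K] [CharZero K]
    (α β : K) (hα : α ≠ 0) (hβ : β ≠ 0)
    (a b c d : ℕ) (ha : 0 < a) (hb : 0 < b) (hc : 0 < c) (hd : 0 < d)
    (habcd : b * c < a * d) :
    ∃ hm : (originIdeal K α β a b c d).IsMaximal,
      FiniteDimensional K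
        (Localization (Ideal.primeCompl (originIdeal K α β a b c d) (hp := hm.isPrime))) ∧
      Module.finrank K
        (Localization (Ideal.primeCompl (originIdeal K α β a b c d) (hp := hm.isPrime)))
        = b * c := by
  have hm := originIdeal_isMaximal (α := α) (β := β) ha hb hc hd
  have := hm.isPrime
  obtain ⟨B⟩ := nonempty_basis_of_isLocalization_originIdeal (β := β) hα ha hb hc hd habcd
    (Localization.AtPrime (originIdeal K α β a b c d))
  refine ⟨hm, Module.Finite.of_basis B, ?_⟩
  rw [Module.finrank_eq_card_basis B, Fintype.card_prod, Fintype.card_fin, Fintype.card_fin,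
    mul_comm]
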